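/- arXiv:2411.09372 — 2 statements merged into one kernel-verified Lean document; each statement's English description precedes it below -/
import Mathlib

section
/- For all (x_1, x_2) ∈ ℂ² with |x_1| < 1 and |x_2| < 1, one has x_1 + x_2 ≠ 2, the identity (2x_1x_2 − x_1 − x_2)/(x_1 + x_2 − 2) = x_1·(x_2 − 1)/(x_1 + x_2 − 2) + x_2·(x_1 − 1)/(x_1 + x_2 − 2), and the bound |(2x_1x_2 − x_1 − x_2)/(x_1 + x_2 − 2)| ≤ 1. In particular, f(x_1,x_2) = (2x_1x_2 − x_1 − x_2)/(x_1 + x_2 − 2) is a bounded holomorphic (rational) function on the open bidisk 𝔻². -/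
/-- The open bidisk `𝔻² ⊆ ℂ²`. -/
def openBidisk : Set (ℂ × ℂ) := {p : ℂ × ℂ | ‖p.1‖ < 1 ∧ ‖p.2‖ < 1}

/-- The hermitian identity exhibiting the gap between the squared moduli of the denominator and the
numerator as a sum of terms that are nonnegative on the closed bidisk. -/
theorem normSq_sub_normSq_bidisk (x y : ℂ) :
    ‖x + y - 2‖ ^ 2 - ‖2 * x * y - x - y‖ ^ 2 =
      2 * (1 - ‖x‖ ^ 2) * ‖1 - y‖ ^ 2 + 2 * (1 - ‖y‖ ^ 2) * ‖1 - x‖ ^ 2 := by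
  simp only [← Complex.normSq_eq_norm_sq, Complex.normSq_apply, Complex.add_re, Complex.add_im,
    Complex.sub_re, Complex.sub_im, Complex.mul_re, Complex.mul_im, Complex.one_re, Complex.one_im,
    Complex.re_ofNat, Complex.im_ofNat]
  ring

theorem add_ne_two_of_norm_lt_one {x y : ℂ} (hx : ‖x‖ < 1) (hy : ‖y‖ < 1) : x + y ≠ 2 := by
  intro h
  have h₁ := norm_add_le x y
  rw [h, Complex.norm_ofNat] at h₁
  linarith

theorem norm_div_le_one_of_norm_lt_one {x y : ℂ} (hx : ‖x‖ < 1) (hy : ‖y‖ < 1) :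
    ‖(2 * x * y - x - y) / (x + y - 2)‖ ≤ 1 := by
  rw [norm_div]
  refine div_le_one_of_le₀ (le_of_pow_le_pow_left₀ two_ne_zero (norm_nonneg _) ?_) (norm_nonneg _)
  have hx' : 0 ≤ 1 - ‖x‖ ^ 2 := sub_nonneg.2 (pow_le_one₀ (norm_nonneg _) hx.le)
  have hy' : 0 ≤ 1 - ‖y‖ ^ 2 := sub_nonneg.2 (pow_le_one₀ (norm_nonneg _) hy.le)
  rw [← sub_nonneg, normSq_sub_normSq_bidisk]
  positivity

/-- For `(x₁, x₂)` in the open bidisk one has `x₁ + x₂ ≠ 2`, the identity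
`(2x₁x₂ − x₁ − x₂)/(x₁ + x₂ − 2) = x₁·(x₂ − 1)/(x₁ + x₂ − 2) + x₂·(x₁ − 1)/(x₁ + x₂ − 2)`,
and the bound `|(2x₁x₂ − x₁ − x₂)/(x₁ + x₂ − 2)| ≤ 1`; in particular
`f(x₁,x₂) = (2x₁x₂ − x₁ − x₂)/(x₁ + x₂ − 2)` is a bounded holomorphic function on `𝔻²`. -/
theorem bounded_rational_on_bidisk :
    (∀ x₁ x₂ : ℂ, ‖x₁‖ < 1 → ‖x₂‖ < 1 →
      x₁ + x₂ ≠ 2 ∧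
      (2 * x₁ * x₂ - x₁ - x₂) / (x₁ + x₂ - 2) =
        x₁ * ((x₂ - 1) / (x₁ + x₂ - 2)) + x₂ * ((x₁ - 1) / (x₁ + x₂ - 2)) ∧
      ‖(2 * x₁ * x₂ - x₁ - x₂) / (x₁ + x₂ - 2)‖ ≤ 1) ∧
    DifferentiableOn ℂ
      (fun p : ℂ × ℂ => (2 * p.1 * p.2 - p.1 - p.2) / (p.1 + p.2 - 2)) openBidisk ∧
    (∀ p ∈ openBidisk, ‖(2 * p.1 * p.2 - p.1 - p.2) / (p.1 + p.2 - 2)‖ ≤ 1) := by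
  refine ⟨fun x₁ x₂ h₁ h₂ => ⟨add_ne_two_of_norm_lt_one h₁ h₂, by ring,
    norm_div_le_one_of_norm_lt_one h₁ h₂⟩, ?_, fun p hp => norm_div_le_one_of_norm_lt_one hp.1 hp.2⟩
  intro p hp
  refine DifferentiableAt.differentiableWithinAt ?_
  have hne : p.1 + p.2 - 2 ≠ 0 := sub_ne_zero.2 (add_ne_two_of_norm_lt_one hp.1 hp.2)
  fun_prop (disch := exact hne)
end

section
/- The function h(x_1, x_2) = (x_2 − 1)/(x_1 + x_2 − 2) is unbounded on the open bidisk 𝔻²: for every M > 0 there exists (x_1, x_2) ∈ ℂ² with |x_1| < 1, |x_2| < 1 and |(x_2 − 1)/(x_1 + x_2 − 2)| > M. Consequently, the bounded holomorphic function f(x_1,x_2) = (2x_1x_2 − x_1 − x_2)/(x_1 + x_2 − 2) on 𝔻² admits the decomposition f(x) = h(x)·x_1 + ((x_1 − 1)/(x_1 + x_2 − 2))·x_2 in which the coefficient function h is unbounded on 𝔻². -/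
/-- The points `1 - ε² ± iε` lie in the unit disk when `0 < ε² < 1`. -/
lemma norm_one_sub_sq_add_mul_I_lt_one {ε : ℝ} (h₀ : ε ≠ 0) (h₁ : ε ^ 2 < 1) :
    ‖(1 - ε ^ 2 + ε * Complex.I : ℂ)‖ < 1 := by
  have h : (1 - ε ^ 2 + ε * Complex.I : ℂ) = ((1 - ε ^ 2 : ℝ) : ℂ) + ε * Complex.I := by
    push_cast; rfl
  rw [h, Complex.norm_add_mul_I, Real.sqrt_lt' one_pos]
  have : 0 < ε ^ 2 := by positivity
  nlinarith

/-- The value of `(x₂ - 1) / (x₁ + x₂ - 2)` at `(1 - ε² + iε, 1 - ε² - iε)`. -/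
lemma coefficient_at_conjugate_points {ε : ℝ} (h₀ : ε ≠ 0) :
    ((1 - ε ^ 2 + (-ε : ℝ) * Complex.I) - 1) /
      ((1 - ε ^ 2 + ε * Complex.I) + (1 - ε ^ 2 + (-ε : ℝ) * Complex.I) - 2) =
      ((1 / 2 : ℝ) : ℂ) + ((1 / (2 * ε) : ℝ) : ℂ) * Complex.I := by
  have hε : (ε : ℂ) ≠ 0 := by exact_mod_cast h₀
  have hd : (1 - ε ^ 2 + ε * Complex.I) + (1 - ε ^ 2 + (-ε : ℝ) * Complex.I) - 2 =
      -(2 * (ε : ℂ) ^ 2) := by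
    push_cast; ring
  rw [hd]
  push_cast
  field_simp
  ring

/-- The function `h(x₁,x₂) = (x₂ − 1)/(x₁ + x₂ − 2)` is unbounded on the
open bidisk, while the bounded holomorphic function
`f(x₁,x₂) = (2x₁x₂ − x₁ − x₂)/(x₁ + x₂ − 2)` admits the decomposition
`f(x) = h(x)·x₁ + ((x₁ − 1)/(x₁ + x₂ − 2))·x₂` whose coefficient `h` is unbounded. -/
theorem unbounded_nc_derivative_coefficient :
    (∀ M : ℝ, 0 < M → ∃ x₁ x₂ : ℂ, ‖x₁‖ < 1 ∧ ‖x₂‖ < 1 ∧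
      ‖(x₂ - 1) / (x₁ + x₂ - 2)‖ > M) ∧
    (∀ x₁ x₂ : ℂ, ‖x₁‖ < 1 → ‖x₂‖ < 1 →
      (2 * x₁ * x₂ - x₁ - x₂) / (x₁ + x₂ - 2) =
        ((x₂ - 1) / (x₁ + x₂ - 2)) * x₁ + ((x₁ - 1) / (x₁ + x₂ - 2)) * x₂) := by
  refine ⟨fun M hM => ?_, fun x₁ x₂ _ _ => by ring⟩
  set ε : ℝ := 1 / (2 * (M + 1)) with hε
  have h₀ : 0 < ε := by positivity
  have h₁ : ε < 1 := by
    rw [hε, div_lt_one (by positivity)]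
    linarith
  have h₂ : ε ^ 2 < 1 := by nlinarith
  have hN : 1 / (2 * ε) = M + 1 := by
    rw [hε]
    field_simp
  refine ⟨1 - ε ^ 2 + ε * Complex.I, 1 - ε ^ 2 + (-ε : ℝ) * Complex.I,
    norm_one_sub_sq_add_mul_I_lt_one h₀.ne' h₂, ?_, ?_⟩
  · simpa using norm_one_sub_sq_add_mul_I_lt_one (ε := -ε)
      (neg_ne_zero.2 h₀.ne') (by simpa using h₂)
  · rw [coefficient_at_conjugate_points h₀.ne', hN]
    refine lt_of_lt_of_le ?_ ((le_abs_self _).trans (Complex.abs_im_le_norm _))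
    simp
end
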